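/- For every n, ℓ ∈ ℕ⁺ and every sequence (a₁, …, a_n) of natural numbers with a_n > 0, if λ₁(R(a₁, …, a_n, 0^{(ℓ)})) ≤ −2, then for every ε > 0 there exists a_{n+1} ∈ ℕ⁺ such that λ₁(R(a₁, …, a_{n−1}, a_n − 1, a_{n+1}, 0^{(ℓ−1)})) < λ₁(R(a₁, …, a_n, 0^{(ℓ)})) + ε. -/

import Mathlib

open Classical

/-- An eigenvalue of a real matrix indexed by a finite type. -/
def IsEigenvalue {V : Type*} [Fintype V] (A : Matrix V V ℝ) (μ : ℝ) : Prop :=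
  ∃ v : V → ℝ, v ≠ 0 ∧ A.mulVec v = μ • v

/-- The adjacency matrix (over ℝ) of a simple graph. -/
noncomputable def adjMat {V : Type*} [Fintype V] (G : SimpleGraph V) : Matrix V V ℝ :=
  fun i j => if G.Adj i j then 1 else 0

/-- The smallest eigenvalue of a real matrix. -/
noncomputable def minEig {V : Type*} [Fintype V] (A : Matrix V V ℝ) : ℝ :=
  sInf {μ : ℝ | IsEigenvalue A μ}

/-- The rowing graph `R(a₁, …, aₙ)` for `a = [a₁, …, aₙ]`. The central path
`v₋₂ v₋₁ v₀ v₁ ⋯ vₙ` is indexed by `Fin (n + 3)` (index `t` is `v_{t-2}`), the coxswain is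
the `Unit` vertex (joined to `v₀`, i.e. index `2`), and for each `i : Fin n` a clique on
`aᵢ₊₁` vertices is joined to `vᵢ` and `vᵢ₊₁` (indices `i + 2` and `i + 3`). -/
def rowingGraph (a : List ℕ) :
    SimpleGraph (Fin (a.length + 3) ⊕ (Unit ⊕ (Σ i : Fin a.length, Fin (a.get i)))) :=
  SimpleGraph.fromRel fun x y =>
    match x, y with
    | Sum.inl s, Sum.inl t => (t : ℕ) = (s : ℕ) + 1
    | Sum.inr (Sum.inl _), Sum.inl t => (t : ℕ) = 2
    | Sum.inr (Sum.inr p), Sum.inl t => (t : ℕ) = (p.1 : ℕ) + 2 ∨ (t : ℕ) = (p.1 : ℕ) + 3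
    | Sum.inr (Sum.inr p), Sum.inr (Sum.inr q) => p.1 = q.1
    | _, _ => False

/-- The smallest eigenvalue of the rowing graph `R(a)`. -/
noncomputable def rowingMinEig (a : List ℕ) : ℝ :=
  minEig (adjMat (rowingGraph a))

open Finset

lemma isHermitian_adjMat {V : Type*} [Fintype V] (G : SimpleGraph V) :
    (adjMat G).IsHermitian := by
  ext i j
  simp [adjMat, G.adj_comm]

lemma finite_setOf_isEigenvalue {V : Type*} [Fintype V] (A : Matrix V V ℝ) :
    {μ : ℝ | IsEigenvalue A μ}.Finite := by
  refine (Module.End.finite_hasEigenvalue (Matrix.toLin' A)).subset ?_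
  rintro μ ⟨v, hv, h⟩
  exact Module.End.hasEigenvalue_of_hasEigenvector
    (x := v) ⟨by simpa [Module.End.mem_eigenspace_iff] using h, hv⟩

lemma isEigenvalue_eigenvalues {V : Type*} [Fintype V] {A : Matrix V V ℝ}
    (hA : A.IsHermitian) (i : V) : IsEigenvalue A (hA.eigenvalues i) := by
  refine ⟨hA.eigenvectorBasis i, ?_, hA.mulVec_eigenvectorBasis i⟩
  intro h
  have := hA.eigenvectorBasis.orthonormal.ne_zero i
  apply this
  ext j
  exact congrFun h j

lemma isEigenvalue_minEig {V : Type*} [Fintype V] [Nonempty V] {A : Matrix V V ℝ}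
    (hA : A.IsHermitian) : IsEigenvalue A (minEig A) :=
  Set.Nonempty.csInf_mem (s := {μ : ℝ | IsEigenvalue A μ})
    ⟨_, isEigenvalue_eigenvalues hA (Classical.arbitrary V)⟩ (finite_setOf_isEigenvalue A)

lemma minEig_mul_dotProduct_le {V : Type*} [Fintype V] {A : Matrix V V ℝ}
    (hA : A.IsHermitian) (x : V → ℝ) : minEig A * (x ⬝ᵥ x) ≤ x ⬝ᵥ A.mulVec x := by
  have hB : (A - minEig A • (1 : Matrix V V ℝ)).IsHermitian :=
    hA.sub (by ext i j; by_cases h : i = j <;> simp [h, eq_comm])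
  have hpos : (A - minEig A • (1 : Matrix V V ℝ)).PosSemidef := by
    rw [hB.posSemidef_iff_eigenvalues_nonneg]
    intro i
    obtain ⟨v, hv, h⟩ := isEigenvalue_eigenvalues hB i
    have hmem : IsEigenvalue A (hB.eigenvalues i + minEig A) := by
      refine ⟨v, hv, ?_⟩
      rw [Matrix.sub_mulVec, Matrix.smul_mulVec, Matrix.one_mulVec, sub_eq_iff_eq_add] at h
      rw [h, add_smul]
    have : minEig A ≤ hB.eigenvalues i + minEig A :=
      csInf_le (finite_setOf_isEigenvalue A).bddBelow hmem
    simpa using this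
  have h := hpos.dotProduct_mulVec_nonneg x
  rw [Matrix.sub_mulVec, Matrix.smul_mulVec, Matrix.one_mulVec, dotProduct_sub,
    dotProduct_smul] at h
  simpa using h

/-- The vector on the vertices of a rowing graph with values `p` along the central path, `c` at
the coxswain and `q` on the cliques. -/
def rowingVec (a : List ℕ) (p : ℕ → ℝ) (c : ℝ) (q : ℕ → ℕ → ℝ) :
    Fin (a.length + 3) ⊕ (Unit ⊕ (Σ i : Fin a.length, Fin (a.get i))) → ℝ :=
  Sum.elim (fun s => p s) (Sum.elim (fun _ => c) fun z => q z.1 z.2)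

lemma exists_eq_rowingVec (a : List ℕ)
    (x : Fin (a.length + 3) ⊕ (Unit ⊕ (Σ i : Fin a.length, Fin (a.get i))) → ℝ) :
    ∃ p c q, x = rowingVec a p c q := by
  refine ⟨fun s => if h : s < a.length + 3 then x (.inl ⟨s, h⟩) else 0, x (.inr (.inl ())),
    fun i j => if h : i < a.length then
      if h' : j < a.get ⟨i, h⟩ then x (.inr (.inr ⟨⟨i, h⟩, ⟨j, h'⟩⟩)) else 0 else 0, ?_⟩
  funext z
  rcases z with s | _ | ⟨i, j⟩
  · simp [rowingVec]
  · simp [rowingVec]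
  · simp [rowingVec]

lemma sum_sigma_get (a : List ℕ) (f : ℕ → ℕ → ℝ) :
    ∑ z : (Σ i : Fin a.length, Fin (a.get i)), f z.1 z.2 =
      ∑ i ∈ range a.length, ∑ j ∈ range (a.getD i 0), f i j := by
  rw [Fintype.sum_sigma, ← Fin.sum_univ_eq_sum_range]
  refine sum_congr rfl fun i _ => ?_
  rw [← Fin.sum_univ_eq_sum_range (f i)]
  have : a.getD i 0 = a.get i := by simp
  rw [this]

/-- The squared norm of `rowingVec`. -/
def rowingNorm (k : ℕ) (α : ℕ → ℕ) (p : ℕ → ℝ) (c : ℝ) (q : ℕ → ℕ → ℝ) : ℝ :=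
  ∑ s ∈ range (k + 3), p s ^ 2 + c ^ 2 + ∑ i ∈ range k, ∑ j ∈ range (α i), q i j ^ 2

/-- The quadratic form of twice the identity plus the adjacency matrix at `rowingVec`, as a sum of
squares over the cliques, up to the contribution of the coxswain. -/
def rowingEnergy (k : ℕ) (α : ℕ → ℕ) (p : ℕ → ℝ) (c : ℝ) (q : ℕ → ℕ → ℝ) : ℝ :=
  p 0 ^ 2 + (p 0 + p 1) ^ 2 + (p 1 + p 2) ^ 2 + 2 * c ^ 2 + 2 * c * p 2 +
    ∑ i ∈ range k, ((p (i + 2) + p (i + 3) + ∑ j ∈ range (α i), q i j) ^ 2 +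
      ∑ j ∈ range (α i), q i j ^ 2) + p (k + 2) ^ 2

lemma rowingVec_dotProduct_self (a : List ℕ) (p : ℕ → ℝ) (c : ℝ) (q : ℕ → ℕ → ℝ) :
    rowingVec a p c q ⬝ᵥ rowingVec a p c q = rowingNorm a.length (fun i => a.getD i 0) p c q := by
  simp only [dotProduct, rowingVec, Fintype.sum_sum_type, Sum.elim_inl, Sum.elim_inr, rowingNorm]
  rw [sum_sigma_get a (fun i j => q i j * q i j),
    Fin.sum_univ_eq_sum_range (fun s => p s * p s) (a.length + 3)]
  simp [sq, add_assoc]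

lemma rowingEnergy_sub_two_mul_rowingNorm (k : ℕ) (α : ℕ → ℕ) (p : ℕ → ℝ) (c : ℝ)
    (q : ℕ → ℕ → ℝ) :
    rowingEnergy k α p c q - 2 * rowingNorm k α p c q =
      2 * ∑ s ∈ range (k + 2), p s * p (s + 1) + 2 * c * p 2 +
        ∑ i ∈ range k, (2 * (∑ j ∈ range (α i), q i j) * (p (i + 2) + p (i + 3)) +
          (∑ j ∈ range (α i), q i j) ^ 2 - ∑ j ∈ range (α i), q i j ^ 2) := by
  unfold rowingEnergy rowingNorm
  induction k with
  | zero => simp [sum_range_succ]; ring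
  | succ k ih =>
    rw [sum_range_succ _ (k + 2 + 1), sum_range_succ _ (k + 2)] at *
    simp only [sum_range_succ _ k, sum_range_succ _ (k + 1), sum_range_succ _ (k + 2)] at *
    linear_combination ih

lemma sum_path_adj (n : ℕ) (p : ℕ → ℝ) :
    ∑ s : Fin (n + 1), ∑ t : Fin (n + 1),
      (if (t : ℕ) = s + 1 ∨ (s : ℕ) = t + 1 then p s * p t else 0) =
      2 * ∑ s ∈ range n, p s * p (s + 1) := by
  have key : ∑ s : Fin (n + 1), ∑ t : Fin (n + 1),
      (if (t : ℕ) = s + 1 then p s * p t else 0) = ∑ s ∈ range n, p s * p (s + 1) := by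
    have h1 : ∀ s : Fin (n + 1), ∑ t : Fin (n + 1), (if (t : ℕ) = s + 1 then p s * p t else 0) =
        if (s : ℕ) < n then p s * p (s + 1) else 0 := by
      intro s
      rw [Fin.sum_univ_eq_sum_range (fun t => if t = (s : ℕ) + 1 then p s * p t else 0) (n + 1)]
      simp
    simp_rw [h1]
    rw [Fin.sum_univ_eq_sum_range (fun s => if s < n then p s * p (s + 1) else 0) (n + 1),
      sum_range_succ]
    simp only [lt_irrefl, if_false, add_zero]
    exact sum_congr rfl fun s hs => if_pos (mem_range.1 hs)
  have h2 : ∀ s t : Fin (n + 1),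
      (if (t : ℕ) = s + 1 ∨ (s : ℕ) = t + 1 then p s * p t else 0) =
        (if (t : ℕ) = s + 1 then p s * p t else 0) +
          (if (s : ℕ) = t + 1 then p t * p s else 0) := by
    intro s t
    by_cases h : (t : ℕ) = s + 1
    · have : ¬ (s : ℕ) = t + 1 := by omega
      rw [if_pos (Or.inl h), if_pos h, if_neg this, add_zero]
    · simp [h, mul_comm]
  simp_rw [h2, sum_add_distrib]
  rw [key, sum_comm, key]
  ring

lemma rowingVec_dotProduct_mulVec (a : List ℕ) (p : ℕ → ℝ) (c : ℝ) (q : ℕ → ℕ → ℝ) :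
    rowingVec a p c q ⬝ᵥ (adjMat (rowingGraph a)).mulVec (rowingVec a p c q) =
      rowingEnergy a.length (fun i => a.getD i 0) p c q -
        2 * rowingNorm a.length (fun i => a.getD i 0) p c q := by
  rw [rowingEnergy_sub_two_mul_rowingNorm]
  have hPP : ∀ s t : Fin (a.length + 3), p s * (adjMat (rowingGraph a) (.inl s) (.inl t) * p t) =
      if (t : ℕ) = s + 1 ∨ (s : ℕ) = t + 1 then p s * p t else 0 := by
    intro s t
    have : ((t : ℕ) = s + 1 ∨ (s : ℕ) = t + 1) → s ≠ t := by rintro h rfl; omega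
    by_cases h : (t : ℕ) = s + 1 ∨ (s : ℕ) = t + 1
    · simp [adjMat, rowingGraph, h, this h]
    · simp [adjMat, rowingGraph, h]
  have hsym : ∀ x y, adjMat (rowingGraph a) x y = adjMat (rowingGraph a) y x := by
    intro x y
    simp [adjMat, (rowingGraph a).adj_comm]
  have hCP : ∀ t : Fin (a.length + 3), adjMat (rowingGraph a) (.inr (.inl ())) (.inl t) =
      if (t : ℕ) = 2 then 1 else 0 := by
    intro t; simp [adjMat, rowingGraph]
  have hCC : adjMat (rowingGraph a) (.inr (.inl ())) (.inr (.inl ())) = 0 := by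
    simp [adjMat]
  have hCQ : ∀ z, adjMat (rowingGraph a) (.inr (.inl ())) (.inr (.inr z)) = 0 := by
    intro z; simp [adjMat, rowingGraph]
  have hQP : ∀ z (t : Fin (a.length + 3)), adjMat (rowingGraph a) (.inr (.inr z)) (.inl t) =
      (if (t : ℕ) = z.1 + 2 then 1 else 0) + (if (t : ℕ) = z.1 + 3 then 1 else 0) := by
    intro z t
    by_cases h : (t : ℕ) = z.1 + 2
    · simp [adjMat, rowingGraph, h]
    · simp [adjMat, rowingGraph, h]
  have hQQ : ∀ z w, adjMat (rowingGraph a) (.inr (.inr z)) (.inr (.inr w)) =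
      (if z.1 = w.1 then 1 else 0) - (if z = w then 1 else 0) := by
    intro z w
    by_cases h : z = w
    · simp [adjMat, h]
    · by_cases h' : z.1 = w.1
      · simp [adjMat, rowingGraph, h, h']
      · simp [adjMat, rowingGraph, h, h', Ne.symm h']
  have hsumP : ∀ r < a.length + 3,
      ∑ t : Fin (a.length + 3), (if (t : ℕ) = r then p t else 0) = p r := by
    intro r hr
    rw [Fin.sum_univ_eq_sum_range (fun t => if t = r then p t else 0) (a.length + 3)]
    simp [hr]
  have sPP := sum_path_adj (a.length + 2) p
  have sCP : ∑ t : Fin (a.length + 3),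
      adjMat (rowingGraph a) (.inr (.inl ())) (.inl t) * p t = p 2 := by
    simp_rw [hCP, ite_mul, one_mul, zero_mul]
    exact hsumP 2 (by omega)
  have sQP : ∀ z, ∑ t : Fin (a.length + 3),
      adjMat (rowingGraph a) (.inr (.inr z)) (.inl t) * p t =
        p ((z.1 : ℕ) + 2) + p ((z.1 : ℕ) + 3) := by
    intro z
    simp_rw [hQP, add_mul, ite_mul, one_mul, zero_mul, sum_add_distrib]
    rw [hsumP _ (by omega), hsumP _ (by omega)]
  have sQQ : ∀ z, ∑ w : (Σ i : Fin a.length, Fin (a.get i)),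
      adjMat (rowingGraph a) (.inr (.inr z)) (.inr (.inr w)) * q w.1 w.2 =
        ∑ j ∈ range (a.getD z.1 0), q z.1 j - q z.1 z.2 := by
    intro z
    simp_rw [hQQ, sub_mul, ite_mul, one_mul, zero_mul, sum_sub_distrib]
    congr 1
    · rw [Fintype.sum_sigma, Finset.sum_eq_single z.1]
      · simp only [if_true]
        rw [Fin.sum_univ_eq_sum_range (q z.1)]
        simp
      · intro i _ hi
        simp [Ne.symm hi]
      · simp
    · simp
  have tot : rowingVec a p c q ⬝ᵥ (adjMat (rowingGraph a)).mulVec (rowingVec a p c q) =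
      (∑ s : Fin (a.length + 3), ∑ t : Fin (a.length + 3),
        p s * (adjMat (rowingGraph a) (.inl s) (.inl t) * p t)) +
      2 * (c * ∑ t : Fin (a.length + 3),
        adjMat (rowingGraph a) (.inr (.inl ())) (.inl t) * p t) +
      ∑ z : (Σ i : Fin a.length, Fin (a.get i)), q z.1 z.2 * (
        2 * (∑ t : Fin (a.length + 3), adjMat (rowingGraph a) (.inr (.inr z)) (.inl t) * p t) +
        ∑ w : (Σ i : Fin a.length, Fin (a.get i)),
          adjMat (rowingGraph a) (.inr (.inr z)) (.inr (.inr w)) * q w.1 w.2) := by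
    have e1 : ∑ s : Fin (a.length + 3), p s *
        ∑ z : (Σ i : Fin a.length, Fin (a.get i)),
          adjMat (rowingGraph a) (.inl s) (.inr (.inr z)) * q z.1 z.2 =
        ∑ z : (Σ i : Fin a.length, Fin (a.get i)), q z.1 z.2 *
          ∑ t : Fin (a.length + 3), adjMat (rowingGraph a) (.inr (.inr z)) (.inl t) * p t := by
      simp_rw [mul_sum]
      rw [sum_comm]
      refine sum_congr rfl fun z _ => sum_congr rfl fun s _ => ?_
      rw [hsym]; ring
    have e2 : ∑ s : Fin (a.length + 3),
        p s * (adjMat (rowingGraph a) (.inl s) (.inr (.inl ())) * c) =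
        c * ∑ t : Fin (a.length + 3),
          adjMat (rowingGraph a) (.inr (.inl ())) (.inl t) * p t := by
      rw [mul_sum]
      refine sum_congr rfl fun s _ => ?_
      rw [hsym]; ring
    have e3 : ∀ z, adjMat (rowingGraph a) (.inr (.inr z)) (.inr (.inl ())) = 0 := by
      intro z; rw [hsym, hCQ]
    simp only [dotProduct, Matrix.mulVec, rowingVec, Fintype.sum_sum_type, Sum.elim_inl,
      Sum.elim_inr, univ_unique, PUnit.default_eq_unit, sum_singleton, mul_add,
      sum_add_distrib, e1, e2, e3, hCQ, hCC]
    simp only [zero_mul, sum_const_zero, mul_zero, add_zero, zero_add, ← mul_sum,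
      mul_left_comm _ (2 : ℝ)]
    ring
  rw [tot]
  simp_rw [hPP, sCP, sQP, sQQ]
  rw [sPP, sum_sigma_get a (fun i j => q i j * (2 * (p (i + 2) + p (i + 3)) +
    (∑ j ∈ range (a.getD i 0), q i j - q i j)))]
  congr 1
  · ring
  · refine sum_congr rfl fun i _ => ?_
    simp_rw [mul_add, mul_sub, sum_add_distrib, sum_sub_distrib, ← sum_mul, sq]
    ring

lemma sq_mul_le_sum_path (t : ℝ) (ht : 0 ≤ t) (ht' : t ≤ 1 / 2) (l : ℕ) (f : ℕ → ℝ) :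
    t ^ 2 * f 0 ^ 2 ≤ ∑ j ∈ range l, (f j + f (j + 1)) ^ 2 + f l ^ 2 +
      t * ∑ j ∈ range l, f (j + 1) ^ 2 := by
  induction l generalizing f with
  | zero =>
    have : t ^ 2 ≤ 1 := by nlinarith
    simpa using mul_le_mul_of_nonneg_right this (sq_nonneg (f 0))
  | succ l ih =>
    have h := ih fun j => f (j + 1)
    rw [sum_range_succ', sum_range_succ']
    simp only [zero_add] at *
    have key : t ^ 2 * f 0 ^ 2 ≤ (f 0 + f 1) ^ 2 + t * f 1 ^ 2 + t ^ 2 * f 1 ^ 2 := by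
      have h1 : t ^ 2 + t ^ 3 ≤ 1 := by nlinarith [mul_nonneg ht ht]
      have h2 : 0 < 1 + t + t ^ 2 := by positivity
      refine le_of_mul_le_mul_left ?_ h2
      nlinarith [sq_nonneg ((1 + t + t ^ 2) * f 1 + f 0),
        mul_nonneg (mul_nonneg ht (sq_nonneg (f 0))) (sub_nonneg.2 h1),
        mul_nonneg ht (sq_nonneg (f 0))]
    linarith

lemma sum_path_eq_zero (l : ℕ) (f : ℕ → ℝ)
    (h : ∑ j ∈ range l, (f j + f (j + 1)) ^ 2 + f l ^ 2 ≤ 0) :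
    f 0 = 0 ∧ ∑ j ∈ range l, f (j + 1) ^ 2 = 0 := by
  induction l generalizing f with
  | zero => simpa [sq_nonpos_iff] using h
  | succ l ih =>
    rw [sum_range_succ'] at h
    simp only [zero_add] at h
    have h0 : 0 ≤ ∑ j ∈ range l, (f (j + 1) + f (j + 1 + 1)) ^ 2 :=
      sum_nonneg fun _ _ => sq_nonneg _
    obtain ⟨h1, h2⟩ := ih (fun j => f (j + 1)) (by nlinarith [sq_nonneg (f 0 + f 1)])
    simp only [zero_add] at h1
    refine ⟨?_, by rw [sum_range_succ', h2]; simp [h1]⟩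
    have : (f 0 + f 1) ^ 2 ≤ 0 := by nlinarith [sq_nonneg (f (l + 1))]
    simpa [h1] using this

/-- The values on the central path of the test vector for the graph in which one vertex of the
`m`-th clique is removed: its value is moved to the vertex of the central path of index `m + 3`,
and the rest of the path is set to zero. -/
def truncatedPath (m : ℕ) (w : ℝ) (p : ℕ → ℝ) (s : ℕ) : ℝ :=
  if s < m + 3 then p s else if s = m + 3 then w else 0

lemma truncatedPath_of_lt {m s : ℕ} (w : ℝ) (p : ℕ → ℝ) (h : s < m + 3) :
    truncatedPath m w p s = p s := if_pos h

lemma truncatedPath_self (m : ℕ) (w : ℝ) (p : ℕ → ℝ) : truncatedPath m w p (m + 3) = w := by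
  simp [truncatedPath]

lemma truncatedPath_of_gt {m s : ℕ} (w : ℝ) (p : ℕ → ℝ) (h : m + 3 < s) :
    truncatedPath m w p s = 0 := by
  rw [truncatedPath, if_neg (by omega), if_neg (by omega)]

lemma rowingEnergy_add (m l : ℕ) (α : ℕ → ℕ) (p : ℕ → ℝ) (c : ℝ) (q : ℕ → ℕ → ℝ)
    (hα : ∀ i, m < i → α i = 0) :
    rowingEnergy (m + 1 + l) α p c q =
      p 0 ^ 2 + (p 0 + p 1) ^ 2 + (p 1 + p 2) ^ 2 + 2 * c ^ 2 + 2 * c * p 2 +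
      ∑ i ∈ range m, ((p (i + 2) + p (i + 3) + ∑ j ∈ range (α i), q i j) ^ 2 +
        ∑ j ∈ range (α i), q i j ^ 2) +
      ((p (m + 2) + p (m + 3) + ∑ j ∈ range (α m), q m j) ^ 2 +
        ∑ j ∈ range (α m), q m j ^ 2) +
      (∑ j ∈ range l, (p (m + 3 + j) + p (m + 3 + (j + 1))) ^ 2 + p (m + 3 + l) ^ 2) := by
  rw [rowingEnergy, sum_range_add, sum_range_succ]
  have : ∀ j, α (m + 1 + j) = 0 := fun j => hα _ (by omega)
  have h2 : ∀ j, m + 1 + j + 2 = m + 3 + j := fun j => by ring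
  have h3 : ∀ j, m + 1 + j + 3 = m + 3 + (j + 1) := fun j => by ring
  simp only [this, range_zero, sum_empty, add_zero, h2, h3]
  ring

lemma rowingNorm_add (m l : ℕ) (α : ℕ → ℕ) (p : ℕ → ℝ) (c : ℝ) (q : ℕ → ℕ → ℝ)
    (hα : ∀ i, m < i → α i = 0) :
    rowingNorm (m + 1 + l) α p c q =
      ∑ s ∈ range (m + 3), p s ^ 2 + c ^ 2 +
      ∑ i ∈ range m, ∑ j ∈ range (α i), q i j ^ 2 + ∑ j ∈ range (α m), q m j ^ 2 +
      p (m + 3) ^ 2 + ∑ j ∈ range l, p (m + 3 + (j + 1)) ^ 2 := by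
  rw [rowingNorm, show m + 1 + l + 3 = (m + 3) + (l + 1) by ring, sum_range_add (fun s => p s ^ 2),
    sum_range_succ' _ l, sum_range_add _ (m + 1), sum_range_succ _ m]
  have : ∀ j, α (m + 1 + j) = 0 := fun j => hα _ (by omega)
  simp only [this, range_zero, sum_empty, sum_const_zero, add_zero]
  ring

lemma rowingEnergy_truncatedPath (m l M : ℕ) (hM : 0 < M) (β : ℕ → ℕ) (w : ℝ) (p : ℕ → ℝ) (c : ℝ)
    (q : ℕ → ℕ → ℝ) (hβM : β (m + 1) = M) (hβ : ∀ i, m + 1 < i → β i = 0) :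
    rowingEnergy (m + 1 + (l + 1)) β (truncatedPath m w p) c
        (fun i j => if i ≤ m then q i j else -w / M) =
      p 0 ^ 2 + (p 0 + p 1) ^ 2 + (p 1 + p 2) ^ 2 + 2 * c ^ 2 + 2 * c * p 2 +
      ∑ i ∈ range m, ((p (i + 2) + p (i + 3) + ∑ j ∈ range (β i), q i j) ^ 2 +
        ∑ j ∈ range (β i), q i j ^ 2) +
      ((p (m + 2) + w + ∑ j ∈ range (β m), q m j) ^ 2 + ∑ j ∈ range (β m), q m j ^ 2) +
      w ^ 2 / M := by
  have hM' : (M : ℝ) ≠ 0 := by positivity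
  rw [show m + 1 + (l + 1) = (m + 1) + 1 + l by ring, rowingEnergy_add (m + 1) l β _ _ _ hβ,
    sum_range_succ]
  have h0 : ∀ j, truncatedPath m w p (m + 1 + 3 + j) = 0 :=
    fun j => truncatedPath_of_gt _ _ (by omega)
  have hsum : ∑ i ∈ range m, ((truncatedPath m w p (i + 2) + truncatedPath m w p (i + 3) +
        ∑ j ∈ range (β i), (if i ≤ m then q i j else -w / M)) ^ 2 +
        ∑ j ∈ range (β i), (if i ≤ m then q i j else -w / M) ^ 2) =
      ∑ i ∈ range m, ((p (i + 2) + p (i + 3) + ∑ j ∈ range (β i), q i j) ^ 2 +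
        ∑ j ∈ range (β i), q i j ^ 2) := by
    refine sum_congr rfl fun i hi => ?_
    have hi := mem_range.1 hi
    rw [truncatedPath_of_lt _ _ (by omega), truncatedPath_of_lt _ _ (by omega)]
    simp only [hi.le, if_true]
  rw [hsum, truncatedPath_of_lt _ _ (by omega), truncatedPath_of_lt _ _ (by omega),
    truncatedPath_of_lt _ _ (by omega), truncatedPath_of_lt _ _ (by omega), truncatedPath_self,
    truncatedPath_of_gt (s := m + 1 + 3) _ _ (by omega)]
  simp only [h0, le_refl, if_true, hβM, show ¬ m + 1 ≤ m by omega, if_false, sum_const,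
    card_range, nsmul_eq_mul]
  field_simp
  simp
  ring

lemma rowingNorm_truncatedPath (m l M : ℕ) (hM : 0 < M) (β : ℕ → ℕ) (w : ℝ) (p : ℕ → ℝ) (c : ℝ)
    (q : ℕ → ℕ → ℝ) (hβM : β (m + 1) = M) (hβ : ∀ i, m + 1 < i → β i = 0) :
    rowingNorm (m + 1 + (l + 1)) β (truncatedPath m w p) c
        (fun i j => if i ≤ m then q i j else -w / M) =
      ∑ s ∈ range (m + 3), p s ^ 2 + c ^ 2 +
      ∑ i ∈ range m, ∑ j ∈ range (β i), q i j ^ 2 + ∑ j ∈ range (β m), q m j ^ 2 +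
      w ^ 2 + w ^ 2 / M := by
  have hM' : (M : ℝ) ≠ 0 := by positivity
  rw [show m + 1 + (l + 1) = (m + 1) + 1 + l by ring, rowingNorm_add (m + 1) l β _ _ _ hβ,
    sum_range_succ _ m, show m + 1 + 3 = m + 3 + 1 by ring, sum_range_succ _ (m + 3),
    truncatedPath_self]
  have h0 : ∀ j, truncatedPath m w p (m + 3 + 1 + j) = 0 :=
    fun j => truncatedPath_of_gt _ _ (by omega)
  have hp : ∑ s ∈ range (m + 3), truncatedPath m w p s ^ 2 = ∑ s ∈ range (m + 3), p s ^ 2 :=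
    sum_congr rfl fun s hs => by rw [truncatedPath_of_lt _ _ (mem_range.1 hs)]
  have hsum : ∑ i ∈ range m, ∑ j ∈ range (β i), (if i ≤ m then q i j else -w / M) ^ 2 =
      ∑ i ∈ range m, ∑ j ∈ range (β i), q i j ^ 2 :=
    sum_congr rfl fun i hi => by simp only [(mem_range.1 hi).le, if_true]
  rw [hp, hsum, truncatedPath_of_gt _ _ (by omega)]
  simp only [h0, le_refl, if_true, hβM, show ¬ m + 1 ≤ m by omega, if_false, sum_const,
    card_range, nsmul_eq_mul]
  field_simp
  simp
  ring

/-- From a vector of energy `-t` times its norm, with `t ≥ 0`, one obtains a test vector on the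
graph in which the `m`-th clique loses a vertex and the next one gets `M` vertices. -/
lemma exists_rowingEnergy_lt (m l M : ℕ) (α β : ℕ → ℕ) (hM : 0 < M)
    (hα : ∀ i, m < i → α i = 0) (hβ : ∀ i, m + 1 < i → β i = 0) (hβM : β (m + 1) = M)
    (hαβ : ∀ i < m, β i = α i) (hm : α m = β m + 1) (p : ℕ → ℝ) (c : ℝ) (q : ℕ → ℕ → ℝ) (t ε : ℝ)
    (ht : 0 ≤ t) (hε : 0 < ε) (hMε : 2 / ε ≤ M)
    (hN : 0 < rowingNorm (m + 1 + (l + 1)) α p c q)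
    (hE : rowingEnergy (m + 1 + (l + 1)) α p c q = -t * rowingNorm (m + 1 + (l + 1)) α p c q) :
    ∃ p' q', 0 < rowingNorm (m + 1 + (l + 1)) β p' c q' ∧
      rowingEnergy (m + 1 + (l + 1)) β p' c q' <
        (-t + ε) * rowingNorm (m + 1 + (l + 1)) β p' c q' := by
  set u := q m (β m) with hu
  set w := p (m + 3) + u with hw
  refine ⟨truncatedPath m w p, fun i j => if i ≤ m then q i j else -w / M, ?_⟩
  rw [rowingEnergy_truncatedPath m l M hM β w p c q hβM hβ,
    rowingNorm_truncatedPath m l M hM β w p c q hβM hβ]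
  rw [rowingEnergy_add m (l + 1) α p c q hα, rowingNorm_add m (l + 1) α p c q hα, hm,
    sum_range_succ _ (β m), sum_range_succ _ (β m)] at hE
  rw [rowingNorm_add m (l + 1) α p c q hα, hm, sum_range_succ _ (β m)] at hN
  have hC : ∑ i ∈ range m, ((p (i + 2) + p (i + 3) + ∑ j ∈ range (β i), q i j) ^ 2 +
        ∑ j ∈ range (β i), q i j ^ 2) =
      ∑ i ∈ range m, ((p (i + 2) + p (i + 3) + ∑ j ∈ range (α i), q i j) ^ 2 +
        ∑ j ∈ range (α i), q i j ^ 2) :=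
    sum_congr rfl fun i hi => by rw [hαβ i (mem_range.1 hi)]
  have hD : ∑ i ∈ range m, ∑ j ∈ range (β i), q i j ^ 2 =
      ∑ i ∈ range m, ∑ j ∈ range (α i), q i j ^ 2 :=
    sum_congr rfl fun i hi => by rw [hαβ i (mem_range.1 hi)]
  have hC0 : 0 ≤ ∑ i ∈ range m, ((p (i + 2) + p (i + 3) + ∑ j ∈ range (α i), q i j) ^ 2 +
        ∑ j ∈ range (α i), q i j ^ 2) := by positivity
  have hD0 : 0 ≤ ∑ i ∈ range m, ∑ j ∈ range (α i), q i j ^ 2 := by positivity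
  have hQ0 : 0 ≤ ∑ j ∈ range (β m), q m j ^ 2 := by positivity
  have hB0 : 0 ≤ ∑ j ∈ range (l + 1), p (m + 3 + (j + 1)) ^ 2 := by positivity
  have hT0 : 0 ≤ ∑ j ∈ range (l + 1), (p (m + 3 + j) + p (m + 3 + (j + 1))) ^ 2 +
      p (m + 3 + (l + 1)) ^ 2 := by positivity
  have hP2 : p 2 ^ 2 ≤ ∑ s ∈ range (m + 3), p s ^ 2 :=
    single_le_sum (f := fun s => p s ^ 2) (fun _ _ => sq_nonneg _) (mem_range.2 (by omega))
  have hzero := sum_path_eq_zero (l + 1) fun j => p (m + 3 + j)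
  have hle := fun h => sq_mul_le_sum_path t ht h (l + 1) fun j => p (m + 3 + j)
  simp only [add_zero] at hzero hle
  rw [hC, hD, show p (m + 2) + w + ∑ j ∈ range (β m), q m j =
    p (m + 2) + p (m + 3) + (∑ j ∈ range (β m), q m j + u) by rw [hw]; ring]
  generalize ∑ i ∈ range m, ((p (i + 2) + p (i + 3) + ∑ j ∈ range (α i), q i j) ^ 2 +
        ∑ j ∈ range (α i), q i j ^ 2) = C at *
  generalize ∑ i ∈ range m, ∑ j ∈ range (α i), q i j ^ 2 = D at *
  generalize ∑ j ∈ range (β m), q m j ^ 2 = Q at *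
  generalize ∑ j ∈ range (β m), q m j = S at *
  generalize ∑ j ∈ range (l + 1), p (m + 3 + (j + 1)) ^ 2 = B at *
  generalize ∑ j ∈ range (l + 1), (p (m + 3 + j) + p (m + 3 + (j + 1))) ^ 2 +
      p (m + 3 + (l + 1)) ^ 2 = T at *
  generalize ∑ s ∈ range (m + 3), p s ^ 2 = P at *
  rw [← hu] at hE hN
  generalize p (m + 2) + p (m + 3) + (S + u) = Y at *
  generalize p (m + 3) = y at *
  clear_value u
  have h0 := sq_nonneg (p 0)
  have h01 := sq_nonneg (p 0 + p 1)
  have h12 := sq_nonneg (p 1 + p 2)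
  have hY := sq_nonneg Y
  have hc2 := sq_nonneg (2 * c + p 2)
  have hu2 := sq_nonneg u
  have hy2 := sq_nonneg y
  have hc := sq_nonneg c
  have ht2 : t ≤ 1 / 2 := by
    refine le_of_mul_le_mul_right ?_ hN
    linarith
  have hle := hle ht2
  have hw0 := sq_nonneg w
  have hN' : 0 < P + c ^ 2 + D + Q + w ^ 2 := by
    by_contra! hcon
    have hPz : p 2 ^ 2 = 0 := by linarith [sq_nonneg (p 2)]
    have hp2 : p 2 = 0 := by simpa using hPz
    have htN := mul_nonneg ht hN.le
    rw [hp2] at hE h12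
    have hT : T ≤ 0 := by linarith
    have hu0 : u ^ 2 ≤ 0 := by linarith
    obtain ⟨h1, h2⟩ := hzero hT
    rw [h1, h2] at hN
    linarith
  have hMpos : (0 : ℝ) < M := by exact_mod_cast hM
  have hwM : w ^ 2 / M ≤ ε / 2 * w ^ 2 := by
    rw [div_le_iff₀ hMpos]
    rw [div_le_iff₀ hε] at hMε
    nlinarith
  have hwM0 : 0 ≤ w ^ 2 / M := by positivity
  refine ⟨by linarith, ?_⟩
  have hsq := sq_nonneg (u - t * y)
  have main : p 0 ^ 2 + (p 0 + p 1) ^ 2 + (p 1 + p 2) ^ 2 + 2 * c ^ 2 + 2 * c * p 2 + C +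
      (Y ^ 2 + Q) ≤ -t * (P + c ^ 2 + D + Q + w ^ 2) := by
    rw [hw]
    linear_combination hE + hle + hsq
  have h1 : (t - ε) * (w ^ 2 / M) ≤ 1 / 2 * (w ^ 2 / M) :=
    mul_le_mul_of_nonneg_right (by linarith) hwM0
  have h2 : ε * w ^ 2 ≤ ε * (P + c ^ 2 + D + Q + w ^ 2) :=
    mul_le_mul_of_nonneg_left (by linarith [sq_nonneg (p 2)]) hε.le
  have h3 : 0 < ε * (P + c ^ 2 + D + Q + w ^ 2) := mul_pos hε hN'
  linarith

/-- If `λ₁(R(a₁, …, aₙ, 0^(ℓ))) ≤ -2` (with `aₙ > 0`, `ℓ ≥ 1`), then for every `ε > 0` there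
is `aₙ₊₁ ≥ 1` with
`λ₁(R(a₁, …, aₙ₋₁, aₙ - 1, aₙ₊₁, 0^(ℓ-1))) < λ₁(R(a₁, …, aₙ, 0^(ℓ))) + ε`.
Here the sequence `(a₁, …, aₙ)` with `aₙ > 0` is encoded as `b ++ [aN]`. -/
theorem rowing_decrement (b : List ℕ) (aN ℓ : ℕ) (haN : 0 < aN) (hℓ : 0 < ℓ)
    (h : rowingMinEig (b ++ [aN] ++ List.replicate ℓ 0) ≤ -2)
    (ε : ℝ) (hε : 0 < ε) :
    ∃ a' : ℕ, 0 < a' ∧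
      rowingMinEig (b ++ [aN - 1, a'] ++ List.replicate (ℓ - 1) 0) <
        rowingMinEig (b ++ [aN] ++ List.replicate ℓ 0) + ε := by
  obtain ⟨l, rfl⟩ : ∃ l, ℓ = l + 1 := ⟨ℓ - 1, by omega⟩
  obtain ⟨k, rfl⟩ : ∃ k, aN = k + 1 := ⟨aN - 1, by omega⟩
  simp only [Nat.add_sub_cancel]
  obtain ⟨M, hM⟩ := exists_nat_ge (2 / ε)
  have hM0 : 0 < M := by
    have : (0 : ℝ) < M := lt_of_lt_of_le (by positivity) hM
    exact_mod_cast this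
  refine ⟨M, hM0, ?_⟩
  set a := b ++ [k + 1] ++ List.replicate (l + 1) 0 with ha
  set a' := b ++ [k, M] ++ List.replicate l 0 with ha'
  have hlen : a.length = b.length + 1 + (l + 1) := by simp [ha]; ring
  have hlen' : a'.length = b.length + 1 + (l + 1) := by simp [ha']; ring
  obtain ⟨x, hx, hAx⟩ := isEigenvalue_minEig (isHermitian_adjMat (rowingGraph a))
  obtain ⟨p, c, q, rfl⟩ := exists_eq_rowingVec a x
  have hpos : 0 < rowingVec a p c q ⬝ᵥ rowingVec a p c q :=
    lt_of_le_of_ne (Finset.sum_nonneg fun i _ => mul_self_nonneg _)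
      (Ne.symm (by simpa [dotProduct_self_eq_zero] using hx))
  have hE := rowingVec_dotProduct_mulVec a p c q
  rw [hAx, dotProduct_smul, rowingVec_dotProduct_self, smul_eq_mul] at hE
  rw [rowingVec_dotProduct_self] at hpos
  change rowingMinEig a * _ = _ at hE
  rw [hlen] at hE hpos
  have hα : ∀ i, b.length < i → a.getD i 0 = 0 := by
    intro i hi
    simp only [ha]
    grind
  have hβ : ∀ i, b.length + 1 < i → a'.getD i 0 = 0 := by
    intro i hi
    simp only [ha']
    grind
  have hβM : a'.getD (b.length + 1) 0 = M := by simp [ha']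
  have hαβ : ∀ i < b.length, a'.getD i 0 = a.getD i 0 := by
    intro i hi
    simp [ha, ha', List.getElem?_append_left hi]
  have hm : a.getD b.length 0 = a'.getD b.length 0 + 1 := by simp [ha, ha']
  obtain ⟨p', q', hpos', hlt⟩ := exists_rowingEnergy_lt b.length l M (fun i => a.getD i 0)
    (fun i => a'.getD i 0) hM0 hα hβ hβM hαβ hm p c q (-(rowingMinEig a + 2)) ε (by linarith) hε
    hM hpos (by linarith)
  have hR := minEig_mul_dotProduct_le (isHermitian_adjMat (rowingGraph a'))
    (rowingVec a' p' c q')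
  rw [rowingVec_dotProduct_mulVec, rowingVec_dotProduct_self] at hR
  change rowingMinEig a' * _ ≤ _ at hR
  rw [hlen'] at hR
  refine lt_of_mul_lt_mul_right ?_ hpos'.le
  linarith
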